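/- There do not exist a planar straight-line drawing f of the graph G₃₀, a convex set K ⊆ ℝ², and a set C ⊆ frontier K with C not collinear (¬Collinear ℝ C), such that for every edge uv of G₃₀ the closed segment from f u to f v has nonempty intersection with C. (In words: G₃₀ has no planar straight-line drawing in which all edges are touched by a single convex curve not lying on a line.) -/

import Mathlib

open Set

/-- The vertex of face `k` chosen from the non-adjacent pair `{0, 3}`. -/
def faceA (k : ℕ) : ℕ := 3 * (k % 2)

/-- The vertex of face `k` chosen from the non-adjacent pair `{1, 4}`. -/
def faceB (k : ℕ) : ℕ := 1 + 3 * (k / 2 % 2)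

/-- The vertex of face `k` chosen from the non-adjacent pair `{2, 5}`. -/
def faceC (k : ℕ) : ℕ := 2 + 3 * (k / 4 % 2)

/-- Edge relation generating the graph `G₃₀`: the central octahedron on
vertices `0,…,5` (two distinct such vertices adjacent unless congruent mod 3,
i.e. unless they form one of the pairs `{0,3}`, `{1,4}`, `{2,5}`), together
with, for each of the 8 faces `k` (with face triangle `{a,b,c}` where
`a = faceA k`, `b = faceB k`, `c = faceC k`), three new vertices
`x = 6+3k`, `y = 7+3k`, `z = 8+3k` forming a triangle, with `x` adjacent to
`b` and `c`, `y` adjacent to `a` and `c`, and `z` adjacent to `a` and `b`. -/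
def G30Rel (i j : Fin 30) : Prop :=
  (i.val < 6 ∧ j.val < 6 ∧ i.val % 3 ≠ j.val % 3) ∨
  ∃ k < 8,
    (i.val = 6 + 3 * k ∧ j.val = 7 + 3 * k) ∨
    (i.val = 7 + 3 * k ∧ j.val = 8 + 3 * k) ∨
    (i.val = 8 + 3 * k ∧ j.val = 6 + 3 * k) ∨
    (i.val = 6 + 3 * k ∧ (j.val = faceB k ∨ j.val = faceC k)) ∨
    (i.val = 7 + 3 * k ∧ (j.val = faceA k ∨ j.val = faceC k)) ∨
    (i.val = 8 + 3 * k ∧ (j.val = faceA k ∨ j.val = faceB k))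

/-- The 30-vertex graph obtained from a central octahedron by replacing each of
its 8 faces by a nested copy of the octahedral graph. -/
def G30 : SimpleGraph (Fin 30) := SimpleGraph.fromRel G30Rel

/-- A planar straight-line drawing of a simple graph `G` in the plane. -/
def IsPlanarDrawing {V : Type*} (G : SimpleGraph V)
    (f : V → EuclideanSpace ℝ (Fin 2)) : Prop :=
  Function.Injective f ∧
  (∀ u v u' v', G.Adj u v → G.Adj u' v' → ({u, v} : Set V) ≠ {u', v'} →
    segment ℝ (f u) (f v) ∩ segment ℝ (f u') (f v') ⊆
      f '' (({u, v} : Set V) ∩ {u', v'})) ∧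
  (∀ u v w, G.Adj u v → w ≠ u → w ≠ v → f w ∉ segment ℝ (f u) (f v))

section PlaneGeometry

/-- The Euclidean plane. -/
abbrev Plane : Type := EuclideanSpace ℝ (Fin 2)

/-- The two-dimensional cross product (signed area of a parallelogram). -/
def planeCross (a b : Plane) : ℝ := a 0 * b 1 - a 1 * b 0

theorem planeCross_swap (a b : Plane) : planeCross a b = -planeCross b a := by
  simp only [planeCross]; ring

theorem planeCross_smul_eq (a b c : Plane) :
    planeCross a b • c = planeCross c b • a + planeCross a c • b := by
  ext i
  fin_cases i <;> simp [planeCross] <;> ring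

theorem planeCross_functional (g : Plane →ₗ[ℝ] ℝ) (a b c : Plane) :
    planeCross a b * g c = planeCross c b * g a + planeCross a c * g b := by
  simpa using congrArg g (planeCross_smul_eq a b c)

/-- If `c` lies in the open cone spanned by `a` and `b` with apex `o`, and the segment `oc`
does not reach the segment `ab`, then `c` lies strictly on the near side of `ab`. -/
theorem planeCross_add_lt {o a b c : Plane}
    (hac : 0 < planeCross (a - o) (c - o)) (hcb : 0 < planeCross (c - o) (b - o))
    (hab : 0 < planeCross (a - o) (b - o))
    (hd : Disjoint (segment ℝ o c) (segment ℝ a b)) :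
    planeCross (a - o) (c - o) + planeCross (c - o) (b - o) < planeCross (a - o) (b - o) := by
  by_contra! hle
  have key := planeCross_smul_eq (a - o) (b - o) (c - o)
  set x := planeCross (c - o) (b - o)
  set y := planeCross (a - o) (c - o)
  set d := planeCross (a - o) (b - o)
  have hs : 0 < y + x := by positivity
  refine Set.disjoint_left.mp hd (?_ : o + (d / (y + x)) • (c - o) ∈ _) ?_
  · refine ⟨1 - d / (y + x), d / (y + x), ?_, by positivity, by ring, by module⟩
    rw [sub_nonneg, div_le_one hs]
    exact hle
  · refine ⟨x / (y + x), y / (y + x), by positivity, by positivity, by field_simp; ring, ?_⟩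
    have h1 : (d / (y + x)) • (c - o) = (y + x)⁻¹ • (d • (c - o)) := by
      rw [smul_smul]; congr 1; ring
    rw [h1, key]
    have h2 : (x / (y + x)) + (y / (y + x)) = 1 := by field_simp; ring
    rw [eq_comm]
    calc o + (y + x)⁻¹ • (x • (a - o) + y • (b - o))
      _ = o - (x / (y + x) + y / (y + x)) • o + (x / (y + x)) • a + (y / (y + x)) • b := by
        simp only [div_eq_inv_mul]; module
      _ = _ := by rw [h2]; module

/-- Two segments `ac` and `bd` seen from `o` in the angular order `a, b, c, d`, neither of which
hides an endpoint of the other, must cross. -/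
theorem not_disjoint_segment_of_planeCross {o a b c d : Plane}
    (hab : 0 < planeCross (a - o) (b - o)) (hbc : 0 < planeCross (b - o) (c - o))
    (hcd : 0 < planeCross (c - o) (d - o)) (hac : 0 < planeCross (a - o) (c - o))
    (hbd : 0 < planeCross (b - o) (d - o))
    (h₁ : planeCross (a - o) (b - o) + planeCross (b - o) (c - o) < planeCross (a - o) (c - o))
    (h₂ : planeCross (b - o) (c - o) + planeCross (c - o) (d - o) < planeCross (b - o) (d - o)) :
    ¬ Disjoint (segment ℝ a c) (segment ℝ b d) := by
  have plucker : planeCross (a - o) (c - o) * planeCross (b - o) (d - o) =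
      planeCross (a - o) (b - o) * planeCross (c - o) (d - o) +
      planeCross (a - o) (d - o) * planeCross (b - o) (c - o) := by
    simp only [planeCross]; ring
  have hid : (planeCross (b - o) (d - o) - planeCross (b - o) (c - o) -
        planeCross (c - o) (d - o)) • a +
      (planeCross (a - o) (d - o) - planeCross (b - o) (d - o) - planeCross (a - o) (b - o)) • c =
      (planeCross (a - o) (c - o) - planeCross (a - o) (b - o) - planeCross (b - o) (c - o)) • d +
      (planeCross (a - o) (d - o) - planeCross (a - o) (c - o) -
        planeCross (c - o) (d - o)) • b := by
    ext i
    fin_cases i <;> simp [planeCross] <;> ring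
  set ab := planeCross (a - o) (b - o)
  set ac := planeCross (a - o) (c - o)
  set ad := planeCross (a - o) (d - o)
  set bc := planeCross (b - o) (c - o)
  set bd := planeCross (b - o) (d - o)
  set cd := planeCross (c - o) (d - o)
  have hN : 0 < ad - bd - ab := by
    refine (pos_iff_pos_of_mul_pos ?_).mp hbc
    nlinarith
  have hM : 0 < ad - ac - cd := by
    refine (pos_iff_pos_of_mul_pos ?_).mp hbc
    nlinarith
  have hs : 0 < ad - ab - bc - cd := by linarith
  rw [Set.not_disjoint_iff]
  refine ⟨(ad - ab - bc - cd)⁻¹ • ((bd - bc - cd) • a + (ad - bd - ab) • c),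
    ⟨(bd - bc - cd) / (ad - ab - bc - cd), (ad - bd - ab) / (ad - ab - bc - cd),
      div_nonneg (by linarith) hs.le, div_nonneg hN.le hs.le, ?_, ?_⟩,
    ⟨(ad - ac - cd) / (ad - ab - bc - cd), (ac - ab - bc) / (ad - ab - bc - cd),
      div_nonneg hM.le hs.le, div_nonneg (by linarith) hs.le, ?_, ?_⟩⟩
  · rw [← add_div, div_eq_one_iff_eq hs.ne']; ring
  · simp only [div_eq_inv_mul, mul_smul, smul_add]
  · rw [← add_div, div_eq_one_iff_eq hs.ne']; ring
  · rw [hid]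
    simp only [div_eq_inv_mul, mul_smul, smul_add]
    abel

theorem mem_interior_convexHull_of_planeCross {o a b c : Plane}
    (hac : 0 < planeCross (a - o) (c - o)) (hcb : 0 < planeCross (c - o) (b - o))
    (h : planeCross (a - o) (c - o) + planeCross (c - o) (b - o) < planeCross (a - o) (b - o)) :
    c ∈ interior (convexHull ℝ {o, a, b}) := by
  have hcont (p : Plane) : Continuous fun x : Plane => planeCross (p - o) (x - o) := by
    unfold planeCross; fun_prop
  have hcont' (p : Plane) : Continuous fun x : Plane => planeCross (x - o) (p - o) := by
    unfold planeCross; fun_prop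
  rw [mem_interior]
  refine ⟨{x | 0 < planeCross (a - o) (x - o)} ∩ {x | 0 < planeCross (x - o) (b - o)} ∩
    {x | planeCross (a - o) (x - o) + planeCross (x - o) (b - o) < planeCross (a - o) (b - o)},
    ?_, ?_, ⟨⟨hac, hcb⟩, h⟩⟩
  · rintro x ⟨⟨hax, hxb⟩, hx⟩
    simp only [Set.mem_ofPred_eq] at hax hxb hx
    have key := planeCross_smul_eq (a - o) (b - o) (x - o)
    set y := planeCross (a - o) (x - o)
    set z := planeCross (x - o) (b - o)
    set d := planeCross (a - o) (b - o)
    have hd : 0 < d := by linarith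
    have hx' : x = (1 - z / d - y / d) • o + (z / d) • a + (y / d) • b := by
      have : x - o = d⁻¹ • (z • (a - o) + y • (b - o)) := by
        rw [← key, smul_smul, inv_mul_cancel₀ hd.ne', one_smul]
      rw [sub_eq_iff_eq_add.mp this]
      simp only [div_eq_inv_mul]
      module
    have hw : 0 ≤ 1 - z / d - y / d := by
      rw [sub_sub, ← add_div, sub_nonneg, div_le_one hd]
      linarith
    rw [hx']
    have := (convex_convexHull ℝ {o, a, b}).sum_mem (t := Finset.univ)
      (w := ![1 - z / d - y / d, z / d, y / d]) (z := ![o, a, b]) ?_ ?_ ?_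
    · simpa [Fin.sum_univ_three] using this
    · intro i _
      fin_cases i
      exacts [hw, (div_pos hxb hd).le, (div_pos hax hd).le]
    · simp only [Fin.sum_univ_three, Matrix.cons_val]; ring
    · intro i _
      refine subset_convexHull ℝ _ ?_
      fin_cases i <;> simp
  · exact (((isOpen_lt continuous_const (hcont a)).inter
      (isOpen_lt continuous_const (hcont' b))).inter
      (isOpen_lt ((hcont a).add (hcont' b)) continuous_const))

theorem exists_affineBasis_of_mem_interior {T : Fin 3 → Plane} {x : Plane}
    (hx : x ∈ interior (convexHull ℝ (range T))) : ∃ b : AffineBasis (Fin 3) ℝ Plane, ⇑b = T := by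
  have htop := interior_convexHull_nonempty_iff_affineSpan_eq_top.mp ⟨x, hx⟩
  have hind : AffineIndependent ℝ T := by
    rw [affineIndependent_iff_finrank_vectorSpan_eq ℝ T (n := 2) (by simp),
      ← direction_affineSpan, htop, AffineSubspace.direction_top, finrank_top,
      finrank_euclideanSpace_fin]
  exact ⟨⟨T, hind, htop⟩, rfl⟩

theorem vertex_notMem_interior_convexHull (T : Fin 3 → Plane) (i : Fin 3) :
    T i ∉ interior (convexHull ℝ (range T)) := by
  intro hi
  obtain ⟨b, rfl⟩ := exists_affineBasis_of_mem_interior hi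
  rw [b.interior_convexHull] at hi
  have h := hi (i + 1)
  rw [b.coord_apply_ne (by fin_cases i <;> decide)] at h
  exact lt_irrefl _ h

theorem add_add_eq_sum_fin_three {M : Type*} [AddCommMonoid M] (F : Fin 3 → M) (i : Fin 3) :
    F i + F (i + 1) + F (i + 2) = ∑ j, F j := by
  fin_cases i <;> simp [Fin.sum_univ_three] <;> abel

/-- A segment starting in the interior of a triangle and avoiding its sides stays inside. -/
theorem segment_subset_interior_convexHull {T : Fin 3 → Plane} {u v : Plane}
    (hu : u ∈ interior (convexHull ℝ (range T)))
    (hd : ∀ i j, i ≠ j → Disjoint (segment ℝ u v) (segment ℝ (T i) (T j))) :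
    segment ℝ u v ⊆ interior (convexHull ℝ (range T)) := by
  refine (convex_segment u v).isPreconnected.subset_of_closure_inter_subset isOpen_interior
    ⟨u, left_mem_segment ℝ u v, hu⟩ ?_
  rintro z ⟨hz, hzs⟩
  obtain ⟨b, rfl⟩ := exists_affineBasis_of_mem_interior hu
  have hz' : z ∈ convexHull ℝ (range b) :=
    closure_minimal interior_subset ((finite_range b).isClosed_convexHull ℝ) hz
  rw [b.convexHull_eq_nonneg_coord] at hz'
  rw [b.interior_convexHull]
  intro i
  refine (hz' i).lt_of_ne fun h0 => ?_
  have hsum := b.sum_coord_apply_eq_one z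
  have hcomb := b.linear_combination_coord_eq_self z
  rw [← add_add_eq_sum_fin_three _ i, ← h0] at hsum hcomb
  refine Set.disjoint_left.mp (hd (i + 1) (i + 2) (by fin_cases i <;> decide)) hzs
    ⟨b.coord (i + 1) z, b.coord (i + 2) z, hz' _, hz' _, ?_, ?_⟩
  · simpa using hsum
  · simpa using hcomb

theorem eq_smul_of_planeCross_eq_zero (g : Plane →ₗ[ℝ] ℝ) {a b : Plane}
    (h : planeCross a b = 0) : g b • a = g a • b := by
  have key c := planeCross_functional g a b c
  simp only [h, zero_mul] at key
  have h0 := key (EuclideanSpace.single 0 1)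
  have h1 := key (EuclideanSpace.single 1 1)
  ext i
  fin_cases i <;> simp [planeCross] at h0 h1 ⊢ <;> linarith

theorem mem_segment_or_mem_segment_of_planeCross_eq_zero (g : Plane →ₗ[ℝ] ℝ) {o a b : Plane}
    (ha : g a < g o) (hb : g b < g o) (h : planeCross (a - o) (b - o) = 0) :
    a ∈ segment ℝ o b ∨ b ∈ segment ℝ o a := by
  wlog hab : g b ≤ g a generalizing a b
  · rw [planeCross_swap, neg_eq_zero] at h
    exact (this hb ha h (le_of_not_ge hab)).symm
  left
  have hg := eq_smul_of_planeCross_eq_zero g h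
  rw [map_sub, map_sub] at hg
  have hb' : g b - g o < 0 := by linarith
  have ht : a - o = ((g a - g o) / (g b - g o)) • (b - o) := by
    rw [div_eq_inv_mul, mul_smul, ← hg, smul_smul, inv_mul_cancel₀ hb'.ne, one_smul]
  refine ⟨1 - (g a - g o) / (g b - g o), (g a - g o) / (g b - g o), ?_,
    div_nonneg_of_nonpos (by linarith) hb'.le, by ring, ?_⟩
  · rw [sub_nonneg, div_le_one_of_neg hb']
    linarith
  · generalize (g a - g o) / (g b - g o) = r at ht ⊢
    rw [sub_eq_iff_eq_add.mp ht]
    module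

/-- Let `P i a` be the vertices of a 4-cycle, with `P i false` and `P i true` opposite, drawn
without crossings together with its cone from `o`. If the cycle lies in an open half-plane bounded
by a line through `o`, then one of the triangles formed by `o` and an edge of the cycle contains
the other two vertices. -/
theorem exists_triangle_containing_link {o : Plane} {P : Bool → Bool → Plane} (g : Plane →ₗ[ℝ] ℝ)
    (hg : ∀ i a, g (P i a) < g o)
    (hvis : ∀ i a j b, (i, a) ≠ (j, b) → P i a ∉ segment ℝ o (P j b))
    (hspoke : ∀ i a b, Disjoint (segment ℝ o (P i a)) (segment ℝ (P i (!a)) (P (!i) b)))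
    (hopp : ∀ i a b, Disjoint (segment ℝ (P i a) (P (!i) b)) (segment ℝ (P i (!a)) (P (!i) (!b)))) :
    ∃ i a b, P i (!a) ∈ interior (convexHull ℝ {o, P i a, P (!i) b}) ∧
      P (!i) (!b) ∈ interior (convexHull ℝ {o, P i a, P (!i) b}) := by
  set u := P false false
  have hpos x (hx : g x < g o) : 0 < g o - g x := by linarith
  let t (x : Plane) : ℝ := planeCross (u - o) (x - o) / (g o - g x)
  have hlt {x y : Plane} (hx : g x < g o) (hy : g y < g o) :
      t x < t y ↔ 0 < planeCross (x - o) (y - o) := by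
    have key := planeCross_functional g (x - o) (y - o) (u - o)
    rw [map_sub, map_sub, map_sub, planeCross_swap (x - o) (u - o)] at key
    have hu := hpos u (hg false false)
    rw [div_lt_div_iff₀ (hpos x hx) (hpos y hy)]
    refine ⟨fun h => pos_of_mul_pos_left (b := g o - g u) ?_ hu.le, fun h => ?_⟩
    · linarith
    · have := mul_pos h hu
      linarith
  have hne {i a j b} (h : (i, a) ≠ (j, b)) : t (P i a) ≠ t (P j b) := by
    intro h0
    have h1 : planeCross (P i a - o) (P j b - o) = 0 := by
      refine le_antisymm ?_ ?_
      · exact not_lt.mp fun hh => h0.not_lt ((hlt (hg _ _) (hg _ _)).mpr hh)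
      · rw [planeCross_swap, Left.nonneg_neg_iff]
        exact not_lt.mp fun hh => h0.not_gt ((hlt (hg _ _) (hg _ _)).mpr hh)
    rcases mem_segment_or_mem_segment_of_planeCross_eq_zero g (hg i a) (hg j b) h1 with h2 | h2
    · exact hvis i a j b h h2
    · exact hvis j b i a h.symm h2
  have hcr {i a j b} (h : t (P i a) < t (P j b)) : 0 < planeCross (P i a - o) (P j b - o) :=
    (hlt (hg _ _) (hg _ _)).mp h
  have hspoke' i a b : Disjoint (segment ℝ o (P i a)) (segment ℝ (P (!i) b) (P i (!a))) := by
    rw [segment_symm ℝ (P (!i) b)]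
    exact hspoke i a b
  obtain ⟨⟨i, a⟩, hmin⟩ := Finite.exists_min fun k : Bool × Bool => t (P k.1 k.2)
  obtain ⟨⟨j, b⟩, hmax⟩ := Finite.exists_max fun k : Bool × Bool => t (P k.1 k.2)
  have hmin' k c (h : (i, a) ≠ (k, c)) : t (P i a) < t (P k c) :=
    (hmin (k, c)).lt_of_ne (hne h)
  have hmax' k c (h : (k, c) ≠ (j, b)) : t (P k c) < t (P j b) :=
    (hmax (k, c)).lt_of_ne (hne h)
  obtain rfl | hij := eq_or_ne i j
  · exfalso
    obtain rfl | hab := eq_or_ne b a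
    · exact (hmin' (!i) b (by simp)).not_gt (hmax' (!i) b (by simp))
    obtain rfl : b = !a := Bool.eq_not_of_ne hab
    obtain ⟨c, hc⟩ : ∃ c, t (P (!i) c) < t (P (!i) (!c)) := by
      rcases (hne (i := !i) (a := false) (j := !i) (b := true) (by simp)).lt_or_gt with h | h
      exacts [⟨false, h⟩, ⟨true, h⟩]
    have h1 := hmin' (!i) c (by simp)
    have h2 := hmax' (!i) (!c) (by simp)
    refine not_disjoint_segment_of_planeCross (hcr h1) (hcr hc) (hcr h2)
      (hcr (hmin' _ _ (by simp))) (hcr (hmax' _ _ (by simp))) ?_ ?_ ?_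
    · refine planeCross_add_lt (hcr h1) (hcr hc) (hcr (hmin' _ _ (by simp))) ?_
      simpa using hspoke' (!i) c a
    · refine planeCross_add_lt (hcr hc) (hcr h2) (hcr (hmax' _ _ (by simp))) ?_
      simpa using hspoke (!i) (!c) (!a)
    · have := hopp i a (!c)
      rwa [Bool.not_not, segment_symm ℝ (P i (!a))] at this
  · obtain rfl : j = !i := Bool.eq_not_of_ne hij.symm
    refine ⟨i, a, b, ?_, ?_⟩
    · have h1 := hcr (hmin' i (!a) (by simp))
      have h2 := hcr (hmax' i (!a) (by simp))
      refine mem_interior_convexHull_of_planeCross h1 h2 (planeCross_add_lt h1 h2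
        (hcr (hmin' _ _ (by simp))) ?_)
      simpa using hspoke i (!a) b
    · have h1 := hcr (hmin' (!i) (!b) (by simp))
      have h2 := hcr (hmax' (!i) (!b) (by simp))
      refine mem_interior_convexHull_of_planeCross h1 h2 (planeCross_add_lt h1 h2
        (hcr (hmin' _ _ (by simp))) ?_)
      simpa using hspoke' (!i) (!b) a

end PlaneGeometry
section Octahedra

variable {V : Type*} {G : SimpleGraph V} {f : V → Plane}

theorem IsPlanarDrawing.disjoint_segment (hf : IsPlanarDrawing G f) {u v u' v' : V}
    (h : G.Adj u v) (h' : G.Adj u' v') (h₁ : u ≠ u') (h₂ : u ≠ v') (h₃ : v ≠ u') (h₄ : v ≠ v') :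
    Disjoint (segment ℝ (f u) (f v)) (segment ℝ (f u') (f v')) := by
  have hd : ({u, v} : Set V) ∩ {u', v'} = ∅ := by
    ext x
    simp only [mem_inter_iff, mem_insert_iff, mem_singleton_iff, mem_empty_iff_false, iff_false]
    rintro ⟨rfl | rfl, rfl | rfl⟩ <;> contradiction
  have hne : ({u, v} : Set V) ≠ {u', v'} := by
    intro he
    have : u ∈ ({u', v'} : Set V) := he ▸ mem_insert u {v}
    rcases this with rfl | rfl <;> contradiction
  have := hf.2.1 u v u' v' h h' hne
  rwa [hd, image_empty, subset_empty_iff, ← disjoint_iff_inter_eq_empty] at this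

/-- An edge leaving the interior of a drawn triangle of `G` ends there or at a corner. -/
theorem IsPlanarDrawing.mem_interior_of_adj (hf : IsPlanarDrawing G f) {T : Fin 3 → V}
    (hT : ∀ i j, i ≠ j → G.Adj (T i) (T j)) {u v : V} (huv : G.Adj u v)
    (hu : f u ∈ interior (convexHull ℝ (range fun i => f (T i)))) (hv : ∀ i, v ≠ T i) :
    f v ∈ interior (convexHull ℝ (range fun i => f (T i))) := by
  have hu' i : u ≠ T i := by
    rintro rfl
    exact vertex_notMem_interior_convexHull (fun i => f (T i)) i hu
  exact segment_subset_interior_convexHull hu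
    (fun i j hij => hf.disjoint_segment huv (hT i j hij) (hu' i) (hu' j) (hv i) (hv j))
    (right_mem_segment ℝ _ _)

/-- An octahedral subgraph of `G`, with non-adjacent pairs `{φ m false, φ m true}`. -/
def IsOctahedron (G : SimpleGraph V) (φ : Fin 3 → Bool → V) : Prop :=
  (∀ m, φ m false ≠ φ m true) ∧ ∀ m n a b, m ≠ n → G.Adj (φ m a) (φ n b)

/-- The face selected by `F` contains the other three vertices of the octahedron in its interior. -/
def IsOuterFace (f : V → Plane) (φ : Fin 3 → Bool → V) (F : Fin 3 → Bool) : Prop :=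
  ∀ n, f (φ n (!F n)) ∈ interior (convexHull ℝ (range fun i => f (φ i (F i))))

variable {φ : Fin 3 → Bool → V}

theorem IsOctahedron.ne (hφ : IsOctahedron G φ) {m n : Fin 3} {a b : Bool}
    (h : (m, a) ≠ (n, b)) : φ m a ≠ φ n b := by
  obtain rfl | hmn := eq_or_ne m n
  · have := hφ.1 m
    cases a <;> cases b <;> simp_all [eq_comm]
  · exact (hφ.2 m n a b hmn).ne

theorem IsOuterFace.mem_convexHull {F : Fin 3 → Bool} (hF : IsOuterFace f φ F) (n : Fin 3)
    (b : Bool) : f (φ n b) ∈ convexHull ℝ (range fun i => f (φ i (F i))) := by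
  obtain rfl | hb := eq_or_ne b (F n)
  · exact subset_convexHull ℝ _ ⟨n, rfl⟩
  · rw [Bool.eq_not_of_ne hb]
    exact interior_subset (hF n)

theorem range_fin_three_eq_insert {α : Type*} (T : Fin 3 → α) (m i j : Fin 3) (hmi : m ≠ i)
    (hmj : m ≠ j) (hij : i ≠ j) : range T = {T m, T i, T j} := by
  ext x
  simp only [mem_range, mem_insert_iff, mem_singleton_iff]
  constructor
  · rintro ⟨k, rfl⟩
    have : k = m ∨ k = i ∨ k = j := by omega
    rcases this with rfl | rfl | rfl <;> simp
  · rintro (rfl | rfl | rfl) <;> exact ⟨_, rfl⟩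

/-- If a linear functional is larger at one vertex of a drawn octahedron than at its neighbours,
then this vertex belongs to the outer face. -/
theorem IsPlanarDrawing.exists_isOuterFace_of_local_max (hf : IsPlanarDrawing G f)
    (hφ : IsOctahedron G φ) (m : Fin 3) (c : Bool) (g : Plane →ₗ[ℝ] ℝ)
    (hg : ∀ n b, n ≠ m → g (f (φ n b)) < g (f (φ m c))) :
    ∃ F, F m = c ∧ IsOuterFace f φ F := by
  let l (i : Bool) : Fin 3 := bif i then m + 1 else m + 2
  have hlm i : l i ≠ m := by cases i <;> fin_cases m <;> decide
  have hll i : l i ≠ l (!i) := by cases i <;> fin_cases m <;> decide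
  have hl_inj : Function.Injective l := by
    intro i j h
    by_contra hij
    obtain rfl := Bool.eq_not_of_ne (Ne.symm hij)
    exact hll i h
  have hmk (i a) (j b) (h : (i, a) ≠ (j, b)) : φ (l i) a ≠ φ (l j) b := by
    refine hφ.ne fun h' => h ?_
    simp only [Prod.mk.injEq] at h' ⊢
    exact ⟨hl_inj h'.1, h'.2⟩
  obtain ⟨i, a, b, ha, hb⟩ := exists_triangle_containing_link (o := f (φ m c))
    (P := fun i a => f (φ (l i) a)) g (fun i a => hg _ _ (hlm i))
    (fun i a j b h => hf.2.2 _ _ _ (hφ.2 _ _ _ _ (hlm j).symm)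
      (hφ.2 _ _ _ _ (hlm i)).ne (hmk i a j b h))
    (fun i a b => hf.disjoint_segment (hφ.2 _ _ _ _ (hlm i).symm) (hφ.2 _ _ _ _ (hll i))
      (hφ.2 _ _ _ _ (hlm i).symm).ne (hφ.2 _ _ _ _ (hlm _).symm).ne
      (hmk _ _ _ _ (by simp)) (hmk _ _ _ _ (by simp)))
    (fun i a b => hf.disjoint_segment (hφ.2 _ _ _ _ (hll i)) (hφ.2 _ _ _ _ (hll i))
      (hmk _ _ _ _ (by simp)) (hmk _ _ _ _ (by simp))
      (hmk _ _ _ _ (by simp)) (hmk _ _ _ _ (by simp)))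
  let F (n : Fin 3) : Bool := if n = m then c else if n = l i then a else b
  have hFm : F m = c := by simp [F]
  have hFi : F (l i) = a := by simp [F, hlm]
  have hFj : F (l !i) = b := by simp [F, hlm, (hll i).symm]
  have hrange : {f (φ m c), f (φ (l i) a), f (φ (l !i) b)} = range fun n => f (φ n (F n)) := by
    rw [range_fin_three_eq_insert _ m (l i) (l !i) (hlm _).symm (hlm _).symm (hll i), hFm, hFi, hFj]
  simp only [hrange] at ha hb
  refine ⟨F, hFm, fun n => ?_⟩
  have hn : n = m ∨ n = l i ∨ n = l !i := by
    have := hlm i; have := hlm (!i); have := hll i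
    omega
  rcases hn with rfl | rfl | rfl
  · refine hf.mem_interior_of_adj (T := fun n => φ n (F n)) (fun i j h => hφ.2 _ _ _ _ h)
      (hφ.2 _ _ _ _ (hlm i)) ha fun k => hφ.ne ?_
    intro h
    simp only [Prod.mk.injEq] at h
    obtain ⟨rfl, h⟩ := h
    simp at h
  · rwa [hFi]
  · rwa [hFj]

theorem IsPlanarDrawing.exists_isOuterFace (hf : IsPlanarDrawing G f) (hφ : IsOctahedron G φ) :
    ∃ F, IsOuterFace f φ F := by
  obtain ⟨⟨m, c⟩, hmax⟩ := Finite.exists_max fun k : Fin 3 × Bool => ‖f (φ k.1 k.2)‖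
  obtain ⟨F, -, hF⟩ := hf.exists_isOuterFace_of_local_max hφ m c (innerₛₗ ℝ (f (φ m c)))
    (fun n b hn => by
      have h1 := hmax (n, b)
      have h2 : f (φ m c) - f (φ n b) ≠ 0 :=
        sub_ne_zero.mpr (hf.1.ne (hφ.2 _ _ _ _ hn.symm).ne)
      have h3 := norm_sub_sq_real (f (φ m c)) (f (φ n b))
      have h4 := norm_pos_iff.mpr h2
      simp only [innerₛₗ_apply_apply, real_inner_self_eq_norm_sq]
      simp only at h1
      nlinarith [norm_nonneg (f (φ n b))])
  exact ⟨F, hF⟩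

/-- If each face of a drawn octahedron `φ` is refined to an octahedron `ψ F` with three new
vertices, then the new vertices lie inside the triangle of some face whose corners are not on the
outer face of `φ`. -/
theorem IsPlanarDrawing.exists_nested_faces (hf : IsPlanarDrawing G f) (hφ : IsOctahedron G φ)
    {ψ : (Fin 3 → Bool) → Fin 3 → Bool → V} (hψ : ∀ F, IsOctahedron G (ψ F))
    (hψ_false : ∀ F m, ψ F m false = φ m (F m)) (hψ_true : ∀ F m n b, ψ F m true ≠ φ n b) :
    ∃ F, IsOuterFace f φ F ∧ IsOuterFace f (ψ fun n => !F n) fun _ => false := by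
  obtain ⟨F, hF⟩ := hf.exists_isOuterFace hφ
  refine ⟨F, hF, ?_⟩
  set χ := ψ fun n => !F n
  have hχ : IsOctahedron G χ := hψ _
  have hχ_false m : χ m false = φ m (!F m) := hψ_false _ m
  have hχ_true m n b : χ m true ≠ φ n b := hψ_true _ m n b
  have hsucc (m : Fin 3) : m + 1 ≠ m := by fin_cases m <;> decide
  have hadj i j (h : i ≠ j) : G.Adj (φ i (F i)) (φ j (F j)) := hφ.2 _ _ _ _ h
  have hin n b : f (χ n b) ∈ interior (convexHull ℝ (range fun i => f (φ i (F i)))) := by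
    cases b
    · rw [hχ_false]
      exact hF n
    · refine hf.mem_interior_of_adj hadj (hχ.2 (n + 1) n false true (hsucc n)) ?_
        fun i => hχ_true n i _
      rw [hχ_false]
      exact hF _
  obtain ⟨F', hF'⟩ := hf.exists_isOuterFace hχ
  suffices F' = fun _ => false by rwa [this] at hF'
  funext m
  by_contra hm
  rw [Bool.not_eq_false] at hm
  have hadj' i j (h : i ≠ j) : G.Adj (χ i (F' i)) (χ j (F' j)) := hχ.2 _ _ _ _ h
  have hne i j : φ i (F i) ≠ χ j (F' j) := by
    cases h : F' j
    · rw [hχ_false]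
      refine hφ.ne fun h' => ?_
      simp only [Prod.mk.injEq] at h'
      obtain ⟨rfl, h'⟩ := h'
      simp at h'
    · exact (hχ_true j i _).symm
  have hm' := hF' m
  rw [hm, Bool.not_true, hχ_false] at hm'
  have h1 i (hi : i ≠ m) :
      f (φ i (F i)) ∈ interior (convexHull ℝ (range fun i => f (χ i (F' i)))) :=
    hf.mem_interior_of_adj hadj' (hφ.2 _ _ _ _ hi.symm) hm' (hne i)
  have h2 i : f (φ i (F i)) ∈ interior (convexHull ℝ (range fun i => f (χ i (F' i)))) := by
    obtain rfl | hi := eq_or_ne i m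
    · exact hf.mem_interior_of_adj hadj' (hadj _ _ (hsucc i)) (h1 _ (hsucc i)) (hne i)
    · exact h1 i hi
  have h3 : convexHull ℝ (range fun i => f (φ i (F i))) ⊆
      interior (convexHull ℝ (range fun i => f (χ i (F' i)))) :=
    convexHull_min (range_subset_iff.mpr h2) (convex_convexHull ℝ _).interior
  exact vertex_notMem_interior_convexHull (fun i => f (χ i (F' i))) 0
    (h3 (interior_subset (hin 0 _)))

/-- In a drawing all of whose edges meet a closed convex set `D`, all vertices of an octahedron
outside its outer face belong to `D`. -/
theorem IsOuterFace.mem_of_forall_adj (hf : IsPlanarDrawing G f) (hφ : IsOctahedron G φ)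
    {F : Fin 3 → Bool} (hF : IsOuterFace f φ F) {D : Set Plane} (hD : Convex ℝ D)
    (hDc : IsClosed D) (htouch : ∀ u v, G.Adj u v → (segment ℝ (f u) (f v) ∩ D).Nonempty)
    (m : Fin 3) : f (φ m (!F m)) ∈ D := by
  by_contra hm
  obtain ⟨g, s, hgs, hs⟩ := geometric_hahn_banach_closed_point hD hDc hm
  obtain ⟨F', hF'm, hF'⟩ := hf.exists_isOuterFace_of_local_max hφ m (!F m) g.toLinearMap
    (fun n b hn => by
      obtain ⟨z, ⟨x, y, hx, hy, hxy, rfl⟩, hz⟩ := htouch _ _ (hφ.2 m n (!F m) b hn.symm)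
      have h1 := hgs _ hz
      simp only [map_add, map_smul, smul_eq_mul] at h1
      change g _ < g _
      by_contra! hle
      have h2 := mul_le_mul_of_nonneg_left hle hy
      have h3 : x * g (f (φ m (!F m))) + y * g (f (φ m (!F m))) = g (f (φ m (!F m))) := by
        rw [← add_mul, hxy, one_mul]
      linarith)
  have hsub : convexHull ℝ (range fun i => f (φ i (F i))) ⊆
      convexHull ℝ (range fun i => f (φ i (F' i))) :=
    convexHull_min (range_subset_iff.mpr fun i => hF'.mem_convexHull i _) (convex_convexHull ℝ _)
  have hmem := interior_mono hsub (hF m)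
  rw [← hF'm] at hmem
  exact vertex_notMem_interior_convexHull (fun i => f (φ i (F' i))) m hmem

theorem IsPlanarDrawing.exists_adj_disjoint_frontier (hf : IsPlanarDrawing G f)
    (hφ : IsOctahedron G φ) {ψ : (Fin 3 → Bool) → Fin 3 → Bool → V}
    (hψ : ∀ F, IsOctahedron G (ψ F)) (hψ_false : ∀ F m, ψ F m false = φ m (F m))
    (hψ_true : ∀ F m n b, ψ F m true ≠ φ n b) {K : Set Plane} (hK : Convex ℝ K) :
    ∃ u v, G.Adj u v ∧ Disjoint (segment ℝ (f u) (f v)) (frontier K) := by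
  by_contra! htouch
  simp only [Set.not_disjoint_iff_nonempty_inter] at htouch
  obtain ⟨F, hF, hF'⟩ := hf.exists_nested_faces hφ hψ hψ_false hψ_true
  have hcl : convexHull ℝ (range fun i => f (ψ (fun n => !F n) i false)) ⊆ closure K := by
    refine convexHull_min (range_subset_iff.mpr fun i => ?_) hK.closure
    rw [hψ_false]
    exact hF.mem_of_forall_adj hf hφ hK.closure isClosed_closure (fun u v huv =>
      (htouch u v huv).mono (inter_subset_inter_right _ frontier_subset_closure)) i
  have hin n : f (ψ (fun n => !F n) n true) ∈ interior (closure K) :=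
    interior_mono hcl (hF' n)
  have hne : (interior K).Nonempty := by
    rw [hK.interior_nonempty_iff_affineSpan_eq_top, eq_top_iff,
      ← hK.closure.interior_nonempty_iff_affineSpan_eq_top.mp ⟨_, hin 0⟩]
    exact affineSpan_le.mpr (closure_minimal (subset_affineSpan ℝ K)
      (AffineSubspace.closed_of_finiteDimensional _))
  rw [hK.interior_closure_eq_interior_of_nonempty_interior hne] at hin
  obtain ⟨z, hz, hzK⟩ := htouch _ _ ((hψ _).2 0 1 true true (by decide))
  exact hzK.2 (hK.interior.segment_subset (hin 0) (hin 1) hz)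

end Octahedra

instance : DecidableRel G30Rel := fun i j => by
  unfold G30Rel
  infer_instance

instance : DecidableRel G30.Adj := fun i j => by
  unfold G30
  infer_instance

/-- The central octahedron of `G₃₀`. -/
def centralOctahedron (m : Fin 3) (b : Bool) : Fin 30 :=
  ⟨m + 3 * b.toNat, by have := b.toNat_lt; omega⟩

/-- The octahedron nested in the face `F` of the central octahedron of `G₃₀`. -/
def nestedOctahedron (F : Fin 3 → Bool) (m : Fin 3) : Bool → Fin 30
  | false => centralOctahedron m (F m)
  | true => ⟨6 + 3 * ((F 0).toNat + 2 * (F 1).toNat + 4 * (F 2).toNat) + m, by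
      have := (F 0).toNat_lt
      have := (F 1).toNat_lt
      have := (F 2).toNat_lt
      omega⟩

theorem isOctahedron_centralOctahedron : IsOctahedron G30 centralOctahedron := by
  unfold IsOctahedron
  decide

theorem isOctahedron_nestedOctahedron (F : Fin 3 → Bool) :
    IsOctahedron G30 (nestedOctahedron F) := by
  obtain ⟨a, b, c, rfl⟩ : ∃ a b c, F = ![a, b, c] :=
    ⟨F 0, F 1, F 2, by ext i; fin_cases i <;> rfl⟩
  unfold IsOctahedron
  revert a b c
  decide

/-- `G₃₀` has no planar straight-line drawing in which all edges are touched by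
a single convex curve not lying on a line. -/
theorem G30_no_convex_curve_touching_all_edges :
    ¬ ∃ (f : Fin 30 → EuclideanSpace ℝ (Fin 2))
        (K C : Set (EuclideanSpace ℝ (Fin 2))),
      IsPlanarDrawing G30 f ∧ Convex ℝ K ∧ C ⊆ frontier K ∧
      ¬ Collinear ℝ C ∧
      ∀ u v, G30.Adj u v → (segment ℝ (f u) (f v) ∩ C).Nonempty := by
  rintro ⟨f, K, C, hf, hK, hC, -, htouch⟩
  obtain ⟨u, v, huv, hd⟩ := hf.exists_adj_disjoint_frontier isOctahedron_centralOctahedron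
    isOctahedron_nestedOctahedron (fun F m => rfl)
    (fun F m n b h => by
      have h' := congrArg Fin.val h
      simp only [nestedOctahedron, centralOctahedron] at h'
      have := b.toNat_lt
      omega) hK
  obtain ⟨z, hz, hzC⟩ := htouch u v huv
  exact Set.disjoint_left.mp hd hz (hC hzC)
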